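/- Correctness of the non-iterative transformation method for the extended Blasius problem: let n > 0 with n ≠ 1/2 and set δ = (2 − n)/(1 − 2n) (note δ ≠ 1 since n > 0). Suppose f* : ℝ → ℝ is twice differentiable, satisfies the initial conditions f*(0) = 0, (f*)'(0) = 0, (f*)''(0) = 1, the function g*(x) = |(f*)''(x)|^(n−1) · (f*)''(x) is differentiable with g*'(x) = −(1/(n+1)) · f*(x) · (f*)''(x) for all x, and (f*)'(x) → L as x → ∞ with L > 0. Set λ = L^(1/(1−δ)) and define f(η) = λ^(−1) · f*(λ^δ · η). Then f is twice differentiable, the function g(η) = |f''(η)|^(n−1) · f''(η) is differentiable with g'(η) = −(1/(n+1)) · f(η) · f''(η) for all η, f(0) = 0, f'(0) = 0, f'(η) → 1 as η → ∞, and the missing initial condition is f''(0) = λ^(2δ−1). -/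

import Mathlib

theorem deriv_const_mul_comp_mul_left (a b : ℝ) (h : ℝ → ℝ) :
    deriv (fun x => a * h (b * x)) = fun x => a * b * deriv h (b * x) := by
  funext x
  rw [deriv_const_mul_field, deriv_comp_mul_left, smul_eq_mul, mul_assoc]

theorem abs_rpow_sub_one_mul_self_mul {c : ℝ} (hc : 0 < c) (p y : ℝ) :
    |c * y| ^ (p - 1) * (c * y) = c ^ p * (|y| ^ (p - 1) * y) := by
  rw [abs_mul, abs_of_pos hc, Real.mul_rpow hc.le (abs_nonneg y), Real.rpow_sub_one hc.ne']
  field_simp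

/-- Correctness of the non-iterative transformation method for the extended
Blasius problem: if `f*` solves the IVP with `f*(0) = (f*)'(0) = 0`,
`(f*)''(0) = 1`, satisfies the governing equation
`d/dx(|(f*)''|^(n−1) (f*)'') = −(1/(n+1)) f* (f*)''`, and `(f*)'(x) → L > 0`
as `x → ∞`, then with `δ = (2−n)/(1−2n)` and `λ = L^(1/(1−δ))` the rescaled
function `f(η) = λ^(−1) f*(λ^δ η)` solves the extended Blasius boundary value
problem and its missing initial condition is `f''(0) = λ^(2δ−1)`. -/
theorem extended_blasius_non_ITM_correctness
    (n δ : ℝ) (hn : 0 < n) (hn2 : n ≠ 1 / 2)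
    (hδ : δ = (2 - n) / (1 - 2 * n))
    (fs : ℝ → ℝ)
    (hfs : Differentiable ℝ fs) (hfs' : Differentiable ℝ (deriv fs))
    (hfs0 : fs 0 = 0) (hfs'0 : deriv fs 0 = 0) (hfs''0 : deriv (deriv fs) 0 = 1)
    (hgs : Differentiable ℝ
      (fun x => |deriv (deriv fs) x| ^ (n - 1) * deriv (deriv fs) x))
    (hode : ∀ x, deriv
        (fun x => |deriv (deriv fs) x| ^ (n - 1) * deriv (deriv fs) x) x
      = -(1 / (n + 1)) * fs x * deriv (deriv fs) x)
    (L : ℝ) (hL : 0 < L)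
    (hlim : Filter.Tendsto (deriv fs) Filter.atTop (nhds L))
    (lam : ℝ) (hlam : lam = L ^ (1 / (1 - δ))) :
    Differentiable ℝ (fun η => lam ^ (-1 : ℝ) * fs (lam ^ δ * η)) ∧
    Differentiable ℝ (deriv (fun η => lam ^ (-1 : ℝ) * fs (lam ^ δ * η))) ∧
    Differentiable ℝ
      (fun η => |deriv (deriv (fun η => lam ^ (-1 : ℝ) * fs (lam ^ δ * η))) η| ^ (n - 1) *
        deriv (deriv (fun η => lam ^ (-1 : ℝ) * fs (lam ^ δ * η))) η) ∧
    (∀ η, deriv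
        (fun η => |deriv (deriv (fun η => lam ^ (-1 : ℝ) * fs (lam ^ δ * η))) η| ^ (n - 1) *
          deriv (deriv (fun η => lam ^ (-1 : ℝ) * fs (lam ^ δ * η))) η) η
      = -(1 / (n + 1)) * ((fun η => lam ^ (-1 : ℝ) * fs (lam ^ δ * η)) η) *
          deriv (deriv (fun η => lam ^ (-1 : ℝ) * fs (lam ^ δ * η))) η) ∧
    (fun η => lam ^ (-1 : ℝ) * fs (lam ^ δ * η)) 0 = 0 ∧
    deriv (fun η => lam ^ (-1 : ℝ) * fs (lam ^ δ * η)) 0 = 0 ∧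
    Filter.Tendsto (deriv (fun η => lam ^ (-1 : ℝ) * fs (lam ^ δ * η)))
      Filter.atTop (nhds 1) ∧
    deriv (deriv (fun η => lam ^ (-1 : ℝ) * fs (lam ^ δ * η))) 0 = lam ^ (2 * δ - 1) := by
  have h1n : 1 - 2 * n ≠ 0 := fun h => hn2 (by linarith)
  have hδn : δ * (1 - 2 * n) = 2 - n := by rw [hδ, div_mul_cancel₀ _ h1n]
  have hδ1 : 1 - δ ≠ 0 := by
    intro h
    obtain rfl : δ = 1 := by linarith
    linarith
  have hlam0 : 0 < lam := hlam ▸ Real.rpow_pos_of_pos hL _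
  have hc0 : 0 < lam ^ (2 * δ - 1) := Real.rpow_pos_of_pos hlam0 _
  have hb0 : 0 < lam ^ δ := Real.rpow_pos_of_pos hlam0 _
  have hlamL : lam ^ (δ - 1) * L = 1 := by
    rw [hlam, ← Real.rpow_mul hL.le,
      show 1 / (1 - δ) * (δ - 1) = -1 by field_simp; ring, Real.rpow_neg_one,
      inv_mul_cancel₀ hL.ne']
  have hd1 : deriv (fun η => lam ^ (-1 : ℝ) * fs (lam ^ δ * η)) =
      fun η => lam ^ (δ - 1) * deriv fs (lam ^ δ * η) := by
    rw [deriv_const_mul_comp_mul_left, ← Real.rpow_add hlam0, neg_add_eq_sub]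
  have hd2 : deriv (fun η => lam ^ (δ - 1) * deriv fs (lam ^ δ * η)) =
      fun η => lam ^ (2 * δ - 1) * deriv (deriv fs) (lam ^ δ * η) := by
    rw [deriv_const_mul_comp_mul_left, ← Real.rpow_add hlam0,
      show δ - 1 + δ = 2 * δ - 1 by ring]
  have hmul : Differentiable ℝ fun η : ℝ => lam ^ δ * η := differentiable_id.const_mul _
  have hexp : (lam ^ (2 * δ - 1)) ^ n * lam ^ δ = lam ^ (-1 : ℝ) * lam ^ (2 * δ - 1) := by
    rw [← Real.rpow_mul hlam0.le, ← Real.rpow_add hlam0, ← Real.rpow_add hlam0]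
    congr 1
    linarith
  simp only [hd1, hd2, abs_rpow_sub_one_mul_self_mul hc0]
  refine ⟨(hfs.comp hmul).const_mul _, (hfs'.comp hmul).const_mul _,
    (hgs.comp hmul).const_mul _, fun η => ?_, by simp [hfs0], by simp [hfs'0], ?_,
    by simp [hfs''0]⟩
  · rw [deriv_const_mul_comp_mul_left _ _
      (fun x => |deriv (deriv fs) x| ^ (n - 1) * deriv (deriv fs) x)]
    simp only [hode, hexp]
    ring
  · have h := (hlim.comp (Filter.tendsto_id.const_mul_atTop hb0)).const_mul (lam ^ (δ - 1))
    rwa [hlamL] at h
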